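/- arXiv:2306.08912 — 3 statements merged into one kernel-verified Lean document; each statement's English description precedes it below -/
import Mathlib

section
/- Let 𝒳 and 𝒴 be finite alphabets and p a joint probability mass function on 𝒳 × 𝒴 with p(x,y) > 0 for all (x,y). Let (X_1,Y_1), ..., (X_M,Y_M) be independent pairs with joint law p, and let Y^M = (Y_1,...,Y_M). For every ε > 0 there exists M₀ such that for all M ≥ M₀, the expected cardinality of the conditional typical set satisfies E[ ‖A_ε^{(M)}(X | Y^M)‖ ] ≥ (1 − ε) 2^{M(H(X|Y)−2ε)}. -/
open MeasureTheory ProbabilityTheory Filter Finset Real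

noncomputable def ent2 {α : Type*} [Fintype α] (q : α → ℝ) : ℝ :=
  -∑ a, q a * Real.logb 2 (q a)

noncomputable def condEnt2 {Ω α β : Type*} [MeasurableSpace Ω] [Fintype α] [Fintype β]
    (μ : Measure Ω) (X : Ω → α) (Y : Ω → β) : ℝ :=
  ent2 (fun ab : α × β => (μ {ω | X ω = ab.1 ∧ Y ω = ab.2}).toReal) -
    ent2 (fun b : β => (μ {ω | Y ω = b}).toReal)

noncomputable def margX {𝒳 𝒴 : Type*} [Fintype 𝒴] (p : 𝒳 → 𝒴 → ℝ) (x : 𝒳) : ℝ := ∑ y, p x y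

noncomputable def margY {𝒳 𝒴 : Type*} [Fintype 𝒳] (p : 𝒳 → 𝒴 → ℝ) (y : 𝒴) : ℝ := ∑ x, p x y

noncomputable def jointEnt {𝒳 𝒴 : Type*} [Fintype 𝒳] [Fintype 𝒴] (p : 𝒳 → 𝒴 → ℝ) : ℝ :=
  ent2 (fun q : 𝒳 × 𝒴 => p q.1 q.2)

noncomputable def condEntXY {𝒳 𝒴 : Type*} [Fintype 𝒳] [Fintype 𝒴] (p : 𝒳 → 𝒴 → ℝ) : ℝ :=
  jointEnt p - ent2 (margY p)

noncomputable def mutInfo {𝒳 𝒴 : Type*} [Fintype 𝒳] [Fintype 𝒴] (p : 𝒳 → 𝒴 → ℝ) : ℝ :=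
  ent2 (margX p) + ent2 (margY p) - jointEnt p

def typ {𝒳 : Type*} [Fintype 𝒳] (P : 𝒳 → ℝ) (ε : ℝ) (M : ℕ) (xs : Fin M → 𝒳) : Prop :=
  |(-(1 / (M : ℝ))) * ∑ m, Real.logb 2 (P (xs m)) - ent2 P| < ε

def jtyp {𝒳 𝒴 : Type*} [Fintype 𝒳] [Fintype 𝒴] (p : 𝒳 → 𝒴 → ℝ) (ε : ℝ) (M : ℕ)
    (xs : Fin M → 𝒳) (ys : Fin M → 𝒴) : Prop :=
  |(-(1 / (M : ℝ))) * ∑ m, Real.logb 2 (margX p (xs m)) - ent2 (margX p)| < ε ∧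
  |(-(1 / (M : ℝ))) * ∑ m, Real.logb 2 (margY p (ys m)) - ent2 (margY p)| < ε ∧
  |(-(1 / (M : ℝ))) * ∑ m, Real.logb 2 (p (xs m) (ys m)) - jointEnt p| < ε

open scoped Classical in
noncomputable def typFinset {𝒳 : Type*} [Fintype 𝒳] (P : 𝒳 → ℝ) (ε : ℝ) (M : ℕ) :
    Finset (Fin M → 𝒳) := Finset.univ.filter (fun xs => typ P ε M xs)

open scoped Classical in
noncomputable def condTypFinset {𝒳 𝒴 : Type*} [Fintype 𝒳] [Fintype 𝒴] (p : 𝒳 → 𝒴 → ℝ)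
    (ε : ℝ) (M : ℕ) (ys : Fin M → 𝒴) : Finset (Fin M → 𝒳) :=
  Finset.univ.filter (fun xs => jtyp p ε M xs ys)

/-- The probability weights of an i.i.d. sequence sum to one. -/
lemma sum_prod_weights_eq_one {Z : Type*} [Fintype Z] (q : Z → ℝ) (hq : ∑ z, q z = 1) (M : ℕ) :
    ∑ zs : Fin M → Z, ∏ m, q (zs m) = 1 := by
  classical
  have h := Finset.prod_univ_sum (fun _ : Fin M => (Finset.univ : Finset Z)) (fun _ z => q z)
  simpa [hq] using h.symm

/-- The sum of i.i.d. centred variables is centred. -/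
lemma sum_prod_weights_mul_sum {Z : Type*} [Fintype Z] (q f : Z → ℝ) (hq : ∑ z, q z = 1)
    (hf : ∑ z, q z * f z = 0) (M : ℕ) :
    ∑ zs : Fin M → Z, (∏ m, q (zs m)) * ∑ m, f (zs m) = 0 := by
  induction M with
  | zero => simp
  | succ M ih =>
    rw [← (Fin.consEquiv fun _ : Fin (M + 1) => Z).sum_comp, Fintype.sum_prod_type]
    have h : ∀ (z : Z) (zs : Fin M → Z),
        (q z * ∏ m, q (zs m)) * (f z + ∑ m, f (zs m)) =
          (q z * f z) * (∏ m, q (zs m)) + q z * ((∏ m, q (zs m)) * ∑ m, f (zs m)) := by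
      intros; ring
    simp [Fin.consEquiv, Fin.prod_univ_succ, Fin.sum_univ_succ, h, Finset.sum_add_distrib,
      ← Finset.mul_sum, ih, sum_prod_weights_eq_one q hq, hf]

/-- The second moment of a sum of i.i.d. centred variables is additive. -/
lemma sum_prod_weights_mul_sq_sum {Z : Type*} [Fintype Z] (q f : Z → ℝ) (hq : ∑ z, q z = 1)
    (hf : ∑ z, q z * f z = 0) (M : ℕ) :
    ∑ zs : Fin M → Z, (∏ m, q (zs m)) * (∑ m, f (zs m)) ^ 2 = M * ∑ z, q z * f z ^ 2 := by
  induction M with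
  | zero => simp
  | succ M ih =>
    rw [← (Fin.consEquiv fun _ : Fin (M + 1) => Z).sum_comp, Fintype.sum_prod_type]
    have h : ∀ (z : Z) (zs : Fin M → Z),
        (q z * ∏ m, q (zs m)) * (f z + ∑ m, f (zs m)) ^ 2 =
          (q z * f z ^ 2) * (∏ m, q (zs m)) +
            (2 * (q z * f z)) * ((∏ m, q (zs m)) * ∑ m, f (zs m)) +
            q z * ((∏ m, q (zs m)) * (∑ m, f (zs m)) ^ 2) := by
      intros; ring
    simp [Fin.consEquiv, Fin.prod_univ_succ, Fin.sum_univ_succ, h, Finset.sum_add_distrib,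
      ← Finset.mul_sum, ih, sum_prod_weights_eq_one q hq, sum_prod_weights_mul_sum q f hq hf,
      ← Finset.sum_mul, hq]
    ring

open scoped Classical in
/-- Chebyshev's inequality for the negated empirical mean of i.i.d. variables. -/
lemma sum_prod_weights_deviation_le {Z : Type*} [Fintype Z] (q f : Z → ℝ) (hq0 : ∀ z, 0 ≤ q z)
    (hq : ∑ z, q z = 1) (h : ℝ) (hf : h = -∑ z, q z * f z) {ε : ℝ} (hε : 0 < ε) {M : ℕ}
    (hM : 0 < M) :
    ∑ zs : Fin M → Z,
        (if |(-(1 / (M : ℝ))) * ∑ m, f (zs m) - h| < ε then 0 else ∏ m, q (zs m)) ≤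
      (∑ z, q z * (f z + h) ^ 2) / ε ^ 2 / M := by
  have hM' : (0 : ℝ) < M := by exact_mod_cast hM
  have hcent : ∑ z, q z * (f z + h) = 0 := by
    simp only [mul_add, Finset.sum_add_distrib, ← Finset.sum_mul, hq, hf]
    ring
  have hsq := sum_prod_weights_mul_sq_sum q (fun z => f z + h) hq hcent M
  have key : ∀ zs : Fin M → Z,
      (if |(-(1 / (M : ℝ))) * ∑ m, f (zs m) - h| < ε then 0 else ∏ m, q (zs m)) ≤
        ((∏ m, q (zs m)) * (∑ m, (f (zs m) + h)) ^ 2) * (1 / (ε ^ 2 * M ^ 2)) := by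
    intro zs
    have hw : 0 ≤ ∏ m, q (zs m) := Finset.prod_nonneg fun _ _ => hq0 _
    split_ifs with hc
    · positivity
    · have hs : ∑ m, (f (zs m) + h) = -(M * ((-(1 / (M : ℝ))) * ∑ m, f (zs m) - h)) := by
        simp only [Finset.sum_add_distrib, Finset.sum_const, Finset.card_univ, Fintype.card_fin,
          nsmul_eq_mul]
        field_simp
        ring
      have hle : ε ^ 2 ≤ ((-(1 / (M : ℝ))) * ∑ m, f (zs m) - h) ^ 2 := by
        rw [← sq_abs ((-(1 / (M : ℝ))) * ∑ m, f (zs m) - h)]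
        exact pow_le_pow_left₀ hε.le (not_lt.mp hc) 2
      rw [hs, mul_assoc, neg_sq, mul_pow]
      refine le_mul_of_one_le_right hw ?_
      rw [mul_one_div, le_div_iff₀ (by positivity), one_mul, mul_comm]
      gcongr
  refine (Finset.sum_le_sum fun zs _ => key zs).trans (le_of_eq ?_)
  rw [← Finset.sum_mul, hsq]
  field_simp

/-- A product of positive reals is two to the sum of their binary logarithms. -/
lemma prod_eq_two_rpow_sum_logb {ι : Type*} [Fintype ι] (a : ι → ℝ) (ha : ∀ i, 0 < a i) :
    ∏ i, a i = (2 : ℝ) ^ ∑ i, Real.logb 2 (a i) := by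
  rw [Real.rpow_sum_of_pos two_pos]
  exact Finset.prod_congr rfl fun i _ =>
    (Real.rpow_logb two_pos (by norm_num) (ha i)).symm

open scoped Classical in
/-- Jointly typical sequences have probability tending to one, with rate `1 / M`. -/
lemma exists_one_sub_div_le_sum_jtyp {𝒳 𝒴 : Type*} [Fintype 𝒳] [Fintype 𝒴] (p : 𝒳 → 𝒴 → ℝ)
    (hp : ∀ x y, 0 ≤ p x y) (hsum : ∑ x, ∑ y, p x y = 1) {ε : ℝ} (hε : 0 < ε) :
    ∃ C : ℝ, ∀ M : ℕ, 0 < M →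
      1 - C / M ≤ ∑ ys : Fin M → 𝒴, ∑ xs : Fin M → 𝒳,
        if jtyp p ε M xs ys then ∏ m, p (xs m) (ys m) else 0 := by
  set q : 𝒳 × 𝒴 → ℝ := fun z => p z.1 z.2 with hqdef
  have hq0 : ∀ z, 0 ≤ q z := fun z => hp _ _
  have hq : ∑ z, q z = 1 := by rw [Fintype.sum_prod_type]; exact hsum
  have hX : ent2 (margX p) = -∑ z, q z * Real.logb 2 (margX p z.1) := by
    rw [ent2, Fintype.sum_prod_type]
    simp only [hqdef, ← Finset.sum_mul]
    rfl
  have hY : ent2 (margY p) = -∑ z, q z * Real.logb 2 (margY p z.2) := by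
    rw [ent2, Fintype.sum_prod_type_right]
    simp only [hqdef, ← Finset.sum_mul]
    rfl
  have hXY : jointEnt p = -∑ z, q z * Real.logb 2 (p z.1 z.2) := rfl
  refine ⟨(∑ z, q z * (Real.logb 2 (margX p z.1) + ent2 (margX p)) ^ 2) / ε ^ 2 +
    (∑ z, q z * (Real.logb 2 (margY p z.2) + ent2 (margY p)) ^ 2) / ε ^ 2 +
    (∑ z, q z * (Real.logb 2 (p z.1 z.2) + jointEnt p) ^ 2) / ε ^ 2, fun M hM => ?_⟩
  have h1 := sum_prod_weights_deviation_le q _ hq0 hq _ hX hε hM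
  have h2 := sum_prod_weights_deviation_le q _ hq0 hq _ hY hε hM
  have h3 := sum_prod_weights_deviation_le q _ hq0 hq _ hXY hε hM
  have hre : (∑ ys : Fin M → 𝒴, ∑ xs : Fin M → 𝒳,
        if jtyp p ε M xs ys then ∏ m, p (xs m) (ys m) else 0) =
      ∑ zs : Fin M → 𝒳 × 𝒴,
        if jtyp p ε M (fun m => (zs m).1) (fun m => (zs m).2) then ∏ m, q (zs m) else 0 := by
    rw [Finset.sum_comm,
      ← (Equiv.arrowProdEquivProdArrow (Fin M) (fun _ => 𝒳) (fun _ => 𝒴)).symm.sum_comp,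
      Fintype.sum_prod_type]
    rfl
  have hunion : ∀ zs : Fin M → 𝒳 × 𝒴, ∏ m, q (zs m) ≤
      (if jtyp p ε M (fun m => (zs m).1) (fun m => (zs m).2) then ∏ m, q (zs m) else 0) +
      (if |(-(1 / (M : ℝ))) * ∑ m, Real.logb 2 (margX p (zs m).1) - ent2 (margX p)| < ε
        then 0 else ∏ m, q (zs m)) +
      (if |(-(1 / (M : ℝ))) * ∑ m, Real.logb 2 (margY p (zs m).2) - ent2 (margY p)| < ε
        then 0 else ∏ m, q (zs m)) +
      (if |(-(1 / (M : ℝ))) * ∑ m, Real.logb 2 (p (zs m).1 (zs m).2) - jointEnt p| < ε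
        then 0 else ∏ m, q (zs m)) := by
    intro zs
    have hw : 0 ≤ ∏ m, q (zs m) := Finset.prod_nonneg fun _ _ => hq0 _
    unfold jtyp
    split_ifs <;> first | linarith | (exfalso; tauto)
  have htot := Finset.sum_le_sum fun zs (_ : zs ∈ Finset.univ) => hunion zs
  rw [sum_prod_weights_eq_one q hq] at htot
  simp only [Finset.sum_add_distrib] at htot
  rw [hre, add_div, add_div]
  linarith

/-- For jointly typical sequences, `p(y^M)` dominates `p(x^M, y^M) 2^{M(H(X|Y) - 2ε)}`. -/
lemma prod_mul_two_rpow_le_of_jtyp {𝒳 𝒴 : Type*} [Fintype 𝒳] [Fintype 𝒴] {p : 𝒳 → 𝒴 → ℝ}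
    (hp : ∀ x y, 0 < p x y) {ε : ℝ} {M : ℕ} {xs : Fin M → 𝒳} {ys : Fin M → 𝒴}
    (h : jtyp p ε M xs ys) :
    (∏ m, p (xs m) (ys m)) * (2 : ℝ) ^ ((M : ℝ) * (condEntXY p - 2 * ε)) ≤
      ∏ m, margY p (ys m) := by
  obtain rfl | hM := Nat.eq_zero_or_pos M
  · simp
  have hM' : (0 : ℝ) < M := by exact_mod_cast hM
  rw [prod_eq_two_rpow_sum_logb _ fun m => hp (xs m) (ys m),
    prod_eq_two_rpow_sum_logb (fun m => margY p (ys m)) fun m =>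
      Finset.sum_pos (fun x _ => hp x (ys m)) ⟨xs m, Finset.mem_univ _⟩,
    ← Real.rpow_add two_pos]
  refine Real.rpow_le_rpow_of_exponent_le one_le_two ?_
  obtain ⟨-, hy, hxy⟩ := h
  have hy' := (abs_lt.mp hy).2
  have hxy' := (abs_lt.mp hxy).1
  set a := ∑ m, Real.logb 2 (margY p (ys m)) with ha
  set b := ∑ m, Real.logb 2 (p (xs m) (ys m)) with hb
  have e : ∀ c : ℝ, c = -(M * ((-(1 / (M : ℝ))) * c)) := fun c => by field_simp
  have hd : (-(1 / (M : ℝ))) * a + (condEntXY p - 2 * ε) ≤ (-(1 / (M : ℝ))) * b := by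
    unfold condEntXY
    linarith
  have hm := mul_le_mul_of_nonneg_left hd hM'.le
  change b + _ ≤ a
  rw [mul_add] at hm
  linarith [e a, e b]

/-- The law of `Y^M` is the product of the second marginal. -/
lemma measure_snd_eq_prod_margY {Ω 𝒳 𝒴 : Type*} [MeasurableSpace Ω]
    (μ : Measure Ω) [IsProbabilityMeasure μ]
    [Fintype 𝒳] [MeasurableSpace 𝒳] [DiscreteMeasurableSpace 𝒳]
    [MeasurableSpace 𝒴] [DiscreteMeasurableSpace 𝒴]
    (p : 𝒳 → 𝒴 → ℝ) (X : ℕ → Ω → 𝒳) (Y : ℕ → Ω → 𝒴)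
    (hmeasX : ∀ n, Measurable (X n)) (hmeasY : ∀ n, Measurable (Y n)) {M : ℕ} (ys : Fin M → 𝒴)
    (hiid : ∀ xs : Fin M → 𝒳,
      (μ {ω | ∀ m : Fin M, X m ω = xs m ∧ Y m ω = ys m}).toReal = ∏ m, p (xs m) (ys m)) :
    (μ {ω | ∀ m : Fin M, Y m ω = ys m}).toReal = ∏ m, margY p (ys m) := by
  classical
  have hset : {ω | ∀ m : Fin M, Y m ω = ys m} =
      ⋃ xs ∈ (Finset.univ : Finset (Fin M → 𝒳)),
        {ω | ∀ m : Fin M, X m ω = xs m ∧ Y m ω = ys m} := by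
    ext ω
    simp only [Set.mem_ofPred_eq, Set.mem_iUnion, Finset.mem_univ, exists_prop, true_and]
    exact ⟨fun h => ⟨fun m => X m ω, fun m => ⟨rfl, h m⟩⟩, fun ⟨_, h⟩ m => (h m).2⟩
  have hdisj : Set.PairwiseDisjoint (↑(Finset.univ : Finset (Fin M → 𝒳)))
      (fun xs : Fin M → 𝒳 => {ω | ∀ m : Fin M, X m ω = xs m ∧ Y m ω = ys m}) := by
    intro xs _ xs' _ hne
    refine Set.disjoint_left.mpr fun ω h h' => hne ?_
    funext m
    exact (h m).1.symm.trans (h' m).1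
  have hms : ∀ xs ∈ (Finset.univ : Finset (Fin M → 𝒳)),
      MeasurableSet {ω | ∀ m : Fin M, X m ω = xs m ∧ Y m ω = ys m} := by
    intro xs _
    rw [Set.ofPred_forall]
    exact MeasurableSet.iInter fun m =>
      (hmeasX m (MeasurableSet.of_discrete (s := {xs m}))).inter
        (hmeasY m (MeasurableSet.of_discrete (s := {ys m})))
  have hprod := Finset.prod_univ_sum (fun _ : Fin M => (Finset.univ : Finset 𝒳))
    (fun m x => p x (ys m))
  rw [hset, measure_biUnion_finset hdisj hms, ENNReal.toReal_sum fun _ _ => measure_ne_top _ _]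
  simp only [hiid, margY, hprod, Fintype.piFinset_univ]

/-- **Expected size of the conditional typical set.** For an i.i.d. sequence of pairs with
joint law `p`, for every `ε > 0` there is `M₀` such that for all `M ≥ M₀` the expected
cardinality of the conditional typical set `A_ε^{(M)}(X | Y^M)` is at least
`(1 − ε) 2^{M(H(X|Y)−2ε)}`.  The expectation is written as a sum over the possible values
`ys` of `Y^M`, weighted by their probabilities. -/
theorem cond_typical_set_expected_card_lower {Ω 𝒳 𝒴 : Type*} [MeasurableSpace Ω]
    (μ : Measure Ω) [IsProbabilityMeasure μ]
    [Fintype 𝒳] [MeasurableSpace 𝒳] [DiscreteMeasurableSpace 𝒳]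
    [Fintype 𝒴] [MeasurableSpace 𝒴] [DiscreteMeasurableSpace 𝒴]
    (p : 𝒳 → 𝒴 → ℝ) (hpos : ∀ x y, 0 < p x y) (hsum : ∑ x, ∑ y, p x y = 1)
    (X : ℕ → Ω → 𝒳) (Y : ℕ → Ω → 𝒴)
    (hmeasX : ∀ n, Measurable (X n)) (hmeasY : ∀ n, Measurable (Y n))
    (hiid : ∀ (M : ℕ) (xs : Fin M → 𝒳) (ys : Fin M → 𝒴),
      (μ {ω | ∀ m : Fin M, X m ω = xs m ∧ Y m ω = ys m}).toReal = ∏ m, p (xs m) (ys m))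
    (ε : ℝ) (hε : 0 < ε) :
    ∃ M₀ : ℕ, ∀ M ≥ M₀,
      (1 - ε) * (2 : ℝ) ^ ((M : ℝ) * (condEntXY p - 2 * ε)) ≤
        ∑ ys : Fin M → 𝒴,
          (μ {ω | ∀ m : Fin M, Y m ω = ys m}).toReal * ((condTypFinset p ε M ys).card : ℝ) := by
  classical
  obtain ⟨C, hC⟩ := exists_one_sub_div_le_sum_jtyp p (fun x y => (hpos x y).le) hsum hε
  obtain ⟨M₀, hM₀⟩ := exists_nat_gt (C / ε)
  refine ⟨max M₀ 1, fun M hM => ?_⟩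
  have hM1 : 0 < M := lt_of_lt_of_le one_pos ((le_max_right _ _).trans hM)
  have hM1' : (0 : ℝ) < M := by exact_mod_cast hM1
  have hCM : C / M ≤ ε := by
    have hle : (M₀ : ℝ) ≤ M := by exact_mod_cast (le_max_left _ _).trans hM
    rw [div_le_iff₀ hM1', ← div_le_iff₀' hε]
    exact hM₀.le.trans hle
  calc (1 - ε) * (2 : ℝ) ^ ((M : ℝ) * (condEntXY p - 2 * ε))
      ≤ (∑ ys : Fin M → 𝒴, ∑ xs : Fin M → 𝒳,
          if jtyp p ε M xs ys then ∏ m, p (xs m) (ys m) else 0) *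
            (2 : ℝ) ^ ((M : ℝ) * (condEntXY p - 2 * ε)) := by
        gcongr
        linarith [hC M hM1]
    _ ≤ ∑ ys : Fin M → 𝒴, ∑ xs : Fin M → 𝒳,
          if jtyp p ε M xs ys then ∏ m, margY p (ys m) else 0 := by
        simp only [Finset.sum_mul]
        refine Finset.sum_le_sum fun ys _ => Finset.sum_le_sum fun xs _ => ?_
        split_ifs with h
        · exact prod_mul_two_rpow_le_of_jtyp hpos h
        · simp
    _ = _ := by
        refine Finset.sum_congr rfl fun ys _ => ?_
        rw [measure_snd_eq_prod_margY μ p X Y hmeasX hmeasY ys fun xs => hiid M xs ys,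
          condTypFinset, ← Finset.sum_filter, Finset.sum_const, nsmul_eq_mul, mul_comm]
end

section
/- Let 𝒳 and 𝒴 be finite alphabets, p a joint probability mass function on 𝒳 × 𝒴 with p(x,y) > 0 for all (x,y), and (X_1,Y_1), ..., (X_M,Y_M) independent pairs with joint law p. Let E be a {0,1}-valued random variable such that, conditionally on E = 1, X^M lies almost surely in A_ε^{(M)}(X), and set P_f^{(M)} = Pr{E = 1}. Define the accuracy Î(X;Y) = H(X) − (1/M) H(X^M | Y^M, E = 0). Then Î(X;Y) ≤ 1/M − (1/M) P_f^{(M)} H(X^M | Y^M, E = 0) + P_f^{(M)} (H(X) + ε) + I(X;Y). -/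
open MeasureTheory ProbabilityTheory Filter Finset Real

lemma mul_ent2_inv_mul {α : Type*} [Fintype α] (q : α → ℝ) {c : ℝ} (hc : c ≠ 0) :
    c * ent2 (fun a => c⁻¹ * q a) = ent2 q + Real.logb 2 c * ∑ a, q a := by
  simp only [ent2, mul_neg, Finset.mul_sum, ← Finset.sum_neg_distrib, ← Finset.sum_add_distrib]
  refine Finset.sum_congr rfl fun a _ => ?_
  rcases eq_or_ne (q a) 0 with h | h
  · simp [h]
  · rw [Real.logb_mul (inv_ne_zero hc) h, Real.logb_inv]
    field_simp
    ring

lemma ent2_equiv {α β : Type*} [Fintype α] [Fintype β] (e : α ≃ β) (q : β → ℝ) :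
    ent2 (fun a => q (e a)) = ent2 q := by
  simp only [ent2]
  rw [← e.sum_comp (fun b => q b * Real.logb 2 (q b))]

lemma sum_pi_prod {α : Type*} [Fintype α] (P : α → ℝ) (M : ℕ) :
    ∑ f : Fin M → α, ∏ m, P (f m) = (∑ a, P a) ^ M := by
  classical
  have := Fintype.prod_sum (fun (_ : Fin M) a => P a)
  simpa using this.symm

/-- The entropy of `M` independent copies is `M` times the entropy of a single one. -/
lemma ent2_pi {α : Type*} [Fintype α] (P : α → ℝ) (hP : ∀ a, 0 < P a) (hs : ∑ a, P a = 1)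
    (M : ℕ) : ent2 (fun f : Fin M → α => ∏ m, P (f m)) = M * ent2 P := by
  classical
  have key (j : Fin M) : ∑ f : Fin M → α, (∏ m, P (f m)) * Real.logb 2 (P (f j)) =
      ∑ a, P a * Real.logb 2 (P a) := by
    have h := Fintype.prod_sum
      (fun (m : Fin M) a => P a * if m = j then Real.logb 2 (P a) else 1)
    simp only [Finset.prod_mul_distrib, Finset.prod_ite_eq', Finset.mem_univ, if_true] at h
    rw [← h, Finset.prod_eq_single j]
    · simp
    · intro m _ hm
      simp [hm, hs]
    · simp
  simp only [ent2]
  have h1 (f : Fin M → α) : Real.logb 2 (∏ m, P (f m)) = ∑ m, Real.logb 2 (P (f m)) :=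
    Real.logb_prod _ _ fun m _ => (hP _).ne'
  simp only [h1, Finset.mul_sum]
  rw [Finset.sum_comm]
  simp [key]

lemma mul_logb_add_mul_logb_le {a b : ℝ} (ha : 0 ≤ a) (hb : 0 ≤ b) :
    a * Real.logb 2 a + b * Real.logb 2 b ≤ (a + b) * Real.logb 2 (a + b) := by
  rcases ha.eq_or_lt with rfl | ha
  · simp
  rcases hb.eq_or_lt with rfl | hb
  · simp
  have h1 : Real.logb 2 a ≤ Real.logb 2 (a + b) :=
    Real.logb_le_logb_of_le one_lt_two ha (by linarith)
  have h2 : Real.logb 2 b ≤ Real.logb 2 (a + b) :=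
    Real.logb_le_logb_of_le one_lt_two hb (by linarith)
  nlinarith

lemma mul_logb_add_le {a b : ℝ} (ha : 0 ≤ a) (hb : 0 ≤ b) :
    (a + b) * Real.logb 2 (a + b) ≤ a * Real.logb 2 a + b * Real.logb 2 b + (a + b) := by
  rcases (add_nonneg ha hb).eq_or_lt with h0 | h0
  · obtain rfl : a = 0 := by linarith
    obtain rfl : b = 0 := by linarith
    simp
  have h := Real.convexOn_mul_log.2 (Set.mem_Ici.2 ha) (Set.mem_Ici.2 hb)
    (by norm_num : (0 : ℝ) ≤ 1 / 2) (by norm_num : (0 : ℝ) ≤ 1 / 2) (by norm_num)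
  simp only [smul_eq_mul] at h
  rw [← mul_add, Real.log_mul (by norm_num) h0.ne', one_div, Real.log_inv] at h
  have hl : 0 < Real.log 2 := Real.log_pos one_lt_two
  simp only [Real.logb]
  have : (a + b) * Real.log (a + b) ≤
      a * Real.log a + b * Real.log b + (a + b) * Real.log 2 := by linarith
  calc _ = ((a + b) * Real.log (a + b)) / Real.log 2 := by ring
    _ ≤ (a * Real.log a + b * Real.log b + (a + b) * Real.log 2) / Real.log 2 := by gcongr
    _ = _ := by field_simp

lemma ent2_add_le {α : Type*} [Fintype α] {q₀ q₁ : α → ℝ} (h₀ : ∀ a, 0 ≤ q₀ a)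
    (h₁ : ∀ a, 0 ≤ q₁ a) : ent2 (fun a => q₀ a + q₁ a) ≤ ent2 q₀ + ent2 q₁ := by
  simp only [ent2, ← neg_add, ← Finset.sum_add_distrib, neg_le_neg_iff]
  exact Finset.sum_le_sum fun a _ => mul_logb_add_mul_logb_le (h₀ a) (h₁ a)

lemma ent2_add_ge {α : Type*} [Fintype α] {q₀ q₁ : α → ℝ} (h₀ : ∀ a, 0 ≤ q₀ a)
    (h₁ : ∀ a, 0 ≤ q₁ a) :
    ent2 q₀ + ent2 q₁ ≤ ent2 (fun a => q₀ a + q₁ a) + ∑ a, (q₀ a + q₁ a) := by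
  have := Finset.sum_le_sum fun a (_ : a ∈ Finset.univ) => mul_logb_add_le (h₀ a) (h₁ a)
  simp only [Finset.sum_add_distrib] at this
  simp only [ent2, Finset.sum_add_distrib]
  linarith

/-- Gibbs' inequality for a sub-probability `q` on pairs against a reference distribution `P` of
the first coordinate whose surprisal is at most `L` on the support of `q`. -/
lemma ent2_sub_ent2_marginal_le {α β : Type*} [Fintype α] [Fintype β] {q : α × β → ℝ}
    (hq : ∀ a, 0 ≤ q a) {P : α → ℝ} (hP : ∀ a, 0 < P a) (hP1 : ∑ a, P a = 1) {L : ℝ}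
    (hL : ∀ a b, q (a, b) ≠ 0 → -Real.logb 2 (P a) ≤ L) :
    ent2 q - ent2 (fun b => ∑ a, q (a, b)) ≤ (∑ ab, q ab) * L := by
  set r : β → ℝ := fun b => ∑ a, q (a, b) with hr
  have hl : 0 < Real.log 2 := Real.log_pos one_lt_two
  have hterm (a : α) (b : β) :
      -(q (a, b) * Real.logb 2 (q (a, b))) + q (a, b) * Real.logb 2 (r b) ≤
        q (a, b) * L + (r b * P a - q (a, b)) / Real.log 2 := by
    have hr0 : q (a, b) ≤ r b :=
      Finset.single_le_sum (f := fun a => q (a, b)) (fun _ _ => hq _) (Finset.mem_univ a)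
    rcases (hq (a, b)).eq_or_lt with h | h
    · rw [← h]
      have : 0 ≤ r b * P a := mul_nonneg ((hq _).trans hr0) (hP a).le
      simp only [zero_mul, neg_zero, add_zero, sub_zero, zero_add]
      positivity
    · have hrp : 0 < r b := h.trans_le hr0
      have h1 := Real.log_le_sub_one_of_pos (div_pos (mul_pos hrp (hP a)) h)
      rw [Real.log_div (mul_pos hrp (hP a)).ne' h.ne', Real.log_mul hrp.ne' (hP a).ne'] at h1
      have h2 := mul_le_mul_of_nonneg_left h1 h.le
      have h3 := mul_le_mul_of_nonneg_left (hL a b h.ne') h.le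
      rw [mul_sub (q (a, b)) (_ / _), mul_div_cancel₀ _ h.ne', mul_one] at h2
      have h4 := div_le_div_of_nonneg_right h2 hl.le
      have h5 : q (a, b) * (Real.log (r b) + Real.log (P a) - Real.log (q (a, b))) / Real.log 2 =
          q (a, b) * Real.logb 2 (r b) + q (a, b) * Real.logb 2 (P a)
            - q (a, b) * Real.logb 2 (q (a, b)) := by
        simp only [Real.logb]; ring
      linarith
  have hsum := Finset.sum_le_sum fun b (_ : b ∈ (Finset.univ : Finset β)) =>
    Finset.sum_le_sum fun a (_ : a ∈ (Finset.univ : Finset α)) => hterm a b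
  simp only [Finset.sum_add_distrib, Finset.sum_neg_distrib, ← Finset.sum_div,
    Finset.sum_sub_distrib, ← Finset.sum_mul, ← Finset.mul_sum, hP1, mul_one] at hsum
  simp only [ent2, Fintype.sum_prod_type_right]
  simp only [hr, sub_self, zero_div, add_zero] at hsum ⊢
  linarith

lemma sum_measureReal_inter_fiber {Ω α : Type*} [MeasurableSpace Ω] (μ : Measure Ω)
    [IsFiniteMeasure μ] [Fintype α] {Z : Ω → α} (hZ : ∀ a, MeasurableSet {ω | Z ω = a})
    (s : Set Ω) : ∑ a, μ.real (s ∩ {ω | Z ω = a}) = μ.real s := by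
  have h := sum_measureReal_preimage_singleton (μ := μ.restrict s) Finset.univ
    (f := Z) (fun a _ => hZ a)
  rw [Finset.coe_univ, Set.preimage_univ, measureReal_restrict_apply_univ] at h
  rw [← h]
  refine Finset.sum_congr rfl fun a _ => ?_
  rw [measureReal_restrict_apply (show MeasurableSet (Z ⁻¹' {a}) from hZ a), Set.inter_comm]
  rfl

lemma measureReal_mul_condEnt2_cond {Ω α β : Type*} [MeasurableSpace Ω] (μ : Measure Ω)
    [IsFiniteMeasure μ] [Fintype α] [Fintype β] {X : Ω → α} {Y : Ω → β}
    (hX : ∀ a, MeasurableSet {ω | X ω = a}) (hY : ∀ b, MeasurableSet {ω | Y ω = b})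
    {s : Set Ω} (hs : MeasurableSet s) :
    μ.real s * condEnt2 (ProbabilityTheory.cond μ s) X Y =
      ent2 (fun ab : α × β => μ.real (s ∩ {ω | X ω = ab.1 ∧ Y ω = ab.2})) -
        ent2 (fun b : β => μ.real (s ∩ {ω | Y ω = b})) := by
  have hXY (ab : α × β) : MeasurableSet {ω | (X ω, Y ω) = ab} := by
    simp only [Prod.ext_iff]
    exact (hX ab.1).inter (hY ab.2)
  have h1 := sum_measureReal_inter_fiber μ hXY s
  have h2 := sum_measureReal_inter_fiber μ hY s
  simp only [Prod.ext_iff] at h1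
  rcases eq_or_ne (μ.real s) 0 with h0 | h0
  · have h3 (t : Set Ω) : μ.real (s ∩ t) = 0 :=
      le_antisymm (h0 ▸ measureReal_mono Set.inter_subset_left) measureReal_nonneg
    simp [h0, h3, ent2]
  · have hc (t : Set Ω) : (ProbabilityTheory.cond μ s t).toReal = (μ.real s)⁻¹ * μ.real (s ∩ t) := by
      simp [ProbabilityTheory.cond_apply hs, Measure.real]
    simp only [condEnt2, hc]
    rw [mul_sub, mul_ent2_inv_mul _ h0, mul_ent2_inv_mul _ h0, h1, h2]
    ring

/-- **Bound on the accuracy.** With `P_f = Pr{E = 1}` and the accuracy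
`Î(X;Y) = H(X) − (1/M) H(X^M | Y^M, E = 0)`, if conditionally on `E = 1` the sequence
`X^M` lies almost surely in `A_ε^{(M)}(X)`, then
`Î(X;Y) ≤ 1/M − (1/M) P_f H(X^M | Y^M, E = 0) + P_f (H(X) + ε) + I(X;Y)`. -/
theorem accuracy_le_bound {Ω 𝒳 𝒴 : Type*} [MeasurableSpace Ω] (μ : Measure Ω)
    [IsProbabilityMeasure μ]
    [Fintype 𝒳] [MeasurableSpace 𝒳] [DiscreteMeasurableSpace 𝒳]
    [Fintype 𝒴] [MeasurableSpace 𝒴] [DiscreteMeasurableSpace 𝒴]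
    (p : 𝒳 → 𝒴 → ℝ) (hpos : ∀ x y, 0 < p x y) (hsum : ∑ x, ∑ y, p x y = 1)
    (ε : ℝ) (hε : 0 < ε) (M : ℕ) (hM : 0 < M)
    (X : Fin M → Ω → 𝒳) (Y : Fin M → Ω → 𝒴)
    (hmeasX : ∀ m, Measurable (X m)) (hmeasY : ∀ m, Measurable (Y m))
    (hiid : ∀ (xs : Fin M → 𝒳) (ys : Fin M → 𝒴),
      (μ {ω | ∀ m : Fin M, X m ω = xs m ∧ Y m ω = ys m}).toReal = ∏ m, p (xs m) (ys m))
    (E : Ω → Fin 2) (hmeasE : Measurable E)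
    (hcond : μ {ω | E ω = 1 ∧ ¬ typ (margX p) ε M (fun m : Fin M => X m ω)} = 0) :
    ent2 (margX p) -
        (1 / (M : ℝ)) *
          condEnt2 (ProbabilityTheory.cond μ {ω | E ω = 0})
            (fun ω (m : Fin M) => X m ω) (fun ω (m : Fin M) => Y m ω)
      ≤ 1 / (M : ℝ) -
          (1 / (M : ℝ)) * (μ {ω | E ω = 1}).toReal *
            condEnt2 (ProbabilityTheory.cond μ {ω | E ω = 0})
              (fun ω (m : Fin M) => X m ω) (fun ω (m : Fin M) => Y m ω) +
          (μ {ω | E ω = 1}).toReal * (ent2 (margX p) + ε) +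
          mutInfo p := by
  have hSX (xs : Fin M → 𝒳) : MeasurableSet {ω | (fun m => X m ω) = xs} := by
    simp only [funext_iff, Set.ofPred_forall]
    exact MeasurableSet.iInter fun m => hmeasX m (MeasurableSet.of_discrete (s := {xs m}))
  have hSY (ys : Fin M → 𝒴) : MeasurableSet {ω | (fun m => Y m ω) = ys} := by
    simp only [funext_iff, Set.ofPred_forall]
    exact MeasurableSet.iInter fun m => hmeasY m (MeasurableSet.of_discrete (s := {ys m}))
  have hSE (e : Fin 2) : MeasurableSet {ω | E ω = e} := hmeasE (measurableSet_singleton e)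
  have hM0 : (0 : ℝ) < M := by exact_mod_cast hM
  set q : Fin 2 → (Fin M → 𝒳) × (Fin M → 𝒴) → ℝ := fun e ab =>
    μ.real ({ω | E ω = e} ∩ {ω | (fun m => X m ω) = ab.1 ∧ (fun m => Y m ω) = ab.2}) with hq
  set r : Fin 2 → (Fin M → 𝒴) → ℝ := fun e b =>
    μ.real ({ω | E ω = e} ∩ {ω | (fun m => Y m ω) = b}) with hr
  have hqr (e : Fin 2) (b : Fin M → 𝒴) : ∑ a, q e (a, b) = r e b := by
    simp only [hr]
    rw [← sum_measureReal_inter_fiber μ hSX]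
    refine Finset.sum_congr rfl fun a _ => congrArg μ.real ?_
    ext ω
    simp only [Set.mem_inter_iff, Set.mem_ofPred_eq]
    tauto
  have hrE (e : Fin 2) : ∑ b, r e b = μ.real {ω | E ω = e} :=
    sum_measureReal_inter_fiber μ hSY _
  have hE : μ.real {ω | E ω = 0} + μ.real {ω | E ω = 1} = 1 := by
    have := sum_measureReal_inter_fiber μ hSE Set.univ
    simpa [Fin.sum_univ_two] using this
  have hqsum (a : Fin M → 𝒳) (b : Fin M → 𝒴) : q 0 (a, b) + q 1 (a, b) = ∏ m, p (a m) (b m) := by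
    rw [← hiid]
    have := sum_measureReal_inter_fiber μ hSE {ω | ∀ m : Fin M, X m ω = a m ∧ Y m ω = b m}
    simp only [Fin.sum_univ_two] at this
    refine Eq.trans ?_ this
    simp only [hq, Set.inter_comm, funext_iff, forall_and]
  have hrsum (b : Fin M → 𝒴) : r 0 b + r 1 b = ∏ m, margY p (b m) := by
    classical
    simp only [margY, Fintype.prod_sum, ← hqr, ← Finset.sum_add_distrib, hqsum]
  have hne : Nonempty 𝒳 := by
    by_contra h
    rw [not_nonempty_iff] at h
    simp at hsum
  have hneY : Nonempty 𝒴 := by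
    by_contra h
    rw [not_nonempty_iff] at h
    simp at hsum
  have hXpos (x : 𝒳) : 0 < margX p x :=
    Finset.sum_pos (fun y _ => hpos x y) Finset.univ_nonempty
  have hYpos (y : 𝒴) : 0 < margY p y :=
    Finset.sum_pos (fun x _ => hpos x y) Finset.univ_nonempty
  have hY1 : ∑ y, margY p y = 1 := by
    rw [← hsum, Finset.sum_comm]
    rfl
  have hentXY : ent2 (fun ab => q 0 ab + q 1 ab) = M * jointEnt p := by
    rw [← ent2_equiv (Equiv.arrowProdEquivProdArrow (Fin M) (fun _ => 𝒳) (fun _ => 𝒴)), jointEnt,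
      ← ent2_pi _ (fun ab => hpos _ _) (by rw [Fintype.sum_prod_type, hsum])]
    congr 1
    ext f
    exact hqsum _ _
  have hentY : ent2 (fun b => r 0 b + r 1 b) = M * ent2 (margY p) := by
    rw [← ent2_pi _ hYpos hY1]
    congr 1
    ext b
    exact hrsum b
  have h1 : ent2 (fun ab => q 0 ab + q 1 ab) ≤ ent2 (q 0) + ent2 (q 1) :=
    ent2_add_le (fun _ => measureReal_nonneg) (fun _ => measureReal_nonneg)
  have h2 : ent2 (r 0) + ent2 (r 1) ≤ ent2 (fun b => r 0 b + r 1 b) + ∑ b, (r 0 b + r 1 b) :=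
    ent2_add_ge (fun _ => measureReal_nonneg) (fun _ => measureReal_nonneg)
  rw [Finset.sum_add_distrib, hrE, hrE, hE] at h2
  have h3 : ent2 (q 1) - ent2 (r 1) ≤ μ.real {ω | E ω = 1} * (M * (ent2 (margX p) + ε)) := by
    have h := ent2_sub_ent2_marginal_le (q := q 1) (fun _ => measureReal_nonneg)
      (P := fun xs => ∏ m, margX p (xs m)) (L := M * (ent2 (margX p) + ε))
      (fun xs => Finset.prod_pos fun m _ => hXpos _)
      (by rw [sum_pi_prod]; simp only [margX, hsum, one_pow]) ?_
    · simpa only [hqr, Fintype.sum_prod_type_right, hrE] using h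
    · intro a b hab
      have htyp : typ (margX p) ε M a := by
        by_contra hn
        refine hab ((measureReal_eq_zero_iff).2 (measure_mono_null ?_ hcond))
        rintro ω ⟨h1, rfl, -⟩
        exact ⟨h1, hn⟩
      rw [Real.logb_prod _ _ fun m _ => (hXpos _).ne']
      have := (abs_lt.1 htyp).2
      have h4 : -(1 / (M : ℝ)) * ∑ m, Real.logb 2 (margX p (a m)) ≤ ent2 (margX p) + ε := by
        linarith
      calc _ = M * (-(1 / (M : ℝ)) * ∑ m, Real.logb 2 (margX p (a m))) := by field_simp
        _ ≤ _ := by gcongr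
  have h0 := measureReal_mul_condEnt2_cond μ hSX hSY (hSE 0)
  change _ = ent2 (q 0) - ent2 (r 0) at h0
  have hE0 : μ.real {ω | E ω = 0} = 1 - μ.real {ω | E ω = 1} := by linarith
  simp only [← measureReal_def]
  rw [hE0] at h0
  generalize condEnt2 (ProbabilityTheory.cond μ {ω | E ω = 0}) (fun ω (m : Fin M) => X m ω)
    (fun ω (m : Fin M) => Y m ω) = C at h0 ⊢
  generalize μ.real {ω | E ω = 1} = π₁ at h0 h3 ⊢
  have hmain : M * jointEnt p - M * ent2 (margY p) ≤
      1 + (1 - π₁) * C + π₁ * (M * (ent2 (margX p) + ε)) := by linarith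
  rw [mutInfo, ← sub_nonneg]
  have : 0 ≤ (1 + (1 - π₁) * C + π₁ * (M * (ent2 (margX p) + ε)) -
      (M * jointEnt p - M * ent2 (margY p))) / M := div_nonneg (by linarith) hM0.le
  refine this.trans_eq ?_
  field_simp
  ring
end

section
/- Let 𝒳 and 𝒴 be finite alphabets and p a joint probability mass function on 𝒳 × 𝒴 with p(x,y) > 0 for all (x,y). For each M, let (X_1,Y_1), ..., (X_M,Y_M) be independent pairs with joint law p, let E^{(M)} be a {0,1}-valued random variable such that conditionally on E^{(M)} = 1 the sequence X^M lies almost surely in A_ε^{(M)}(X), and define P_f^{(M)} = Pr{E^{(M)} = 1} and the accuracy Î_M(X;Y) = H(X) − (1/M) H(X^M | Y^M, E^{(M)} = 0). If P_f^{(M)} → 0 as M → ∞, then limsup_{M→∞} Î_M(X;Y) ≤ I(X;Y). In other words, no test method achieves accuracy greater than the test information when the probability of test failure tends to zero. -/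
open MeasureTheory ProbabilityTheory Filter Finset Real

/-- The conditional entropy, in nats, of the first coordinate given the second for a
nonnegative weight on `α × β`; it is homogeneous of degree one in the weight. -/
noncomputable def condNegMulLog {α β : Type*} [Fintype α] [Fintype β] (A : α → β → ℝ) : ℝ :=
  ∑ b, (∑ a, negMulLog (A a b) - negMulLog (∑ a, A a b))

lemma ent2_eq_sum_negMulLog {α : Type*} [Fintype α] (q : α → ℝ) :
    ent2 q = (∑ a, negMulLog (q a)) / Real.log 2 := by
  simp only [ent2, Real.logb, negMulLog, Finset.sum_div, ← Finset.sum_neg_distrib]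
  exact Finset.sum_congr rfl fun a _ => by ring

lemma negMulLog_add_le {s t : ℝ} (hs : 0 ≤ s) (ht : 0 ≤ t) :
    negMulLog (s + t) ≤ negMulLog s + negMulLog t := by
  rcases hs.eq_or_lt with rfl | hs
  · simp
  rcases ht.eq_or_lt with rfl | ht
  · simp
  have h1 : Real.log s ≤ Real.log (s + t) := Real.log_le_log hs (by linarith)
  have h2 : Real.log t ≤ Real.log (s + t) := Real.log_le_log ht (by linarith)
  simp only [negMulLog]
  nlinarith [mul_le_mul_of_nonneg_left h1 hs.le, mul_le_mul_of_nonneg_left h2 ht.le]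

lemma sum_negMulLog_le {ι : Type*} [Fintype ι] {f : ι → ℝ} (hf : ∀ i, 0 ≤ f i) :
    ∑ i, negMulLog (f i) ≤
      negMulLog (∑ i, f i) + (∑ i, f i) * Real.log (Fintype.card ι) := by
  rcases isEmpty_or_nonempty ι with _ | _
  · simp
  have hN : (0 : ℝ) < Fintype.card ι := by exact_mod_cast Fintype.card_pos
  have h := concaveOn_negMulLog.le_map_sum (t := Finset.univ)
    (w := fun _ : ι => (Fintype.card ι : ℝ)⁻¹) (p := f)
    (fun _ _ => by positivity) (by simp [hN.ne']) (fun i _ => hf i)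
  simp only [smul_eq_mul, ← Finset.mul_sum] at h
  rw [negMulLog_mul] at h
  have hinv : negMulLog (Fintype.card ι : ℝ)⁻¹ =
      (Fintype.card ι : ℝ)⁻¹ * Real.log (Fintype.card ι) := by
    simp [negMulLog]
  rw [hinv] at h
  have h' := mul_le_mul_of_nonneg_left h hN.le
  field_simp at h'
  linarith

lemma negMulLog_add_negMulLog_le {s t : ℝ} (hs : 0 ≤ s) (ht : 0 ≤ t) :
    negMulLog s + negMulLog t ≤ negMulLog (s + t) + (s + t) * Real.log 2 := by
  have h := sum_negMulLog_le (f := ![s, t]) (by intro i; fin_cases i <;> simpa)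
  simpa using h

section CondNegMulLog

variable {α β : Type*} [Fintype α] [Fintype β]

lemma condNegMulLog_add_le {A B : α → β → ℝ} (hA : ∀ a b, 0 ≤ A a b)
    (hB : ∀ a b, 0 ≤ B a b) :
    condNegMulLog (fun a b => A a b + B a b) ≤ condNegMulLog A + condNegMulLog B +
      (∑ b, ∑ a, (A a b + B a b)) * Real.log 2 := by
  simp only [condNegMulLog]
  rw [Finset.sum_mul, ← Finset.sum_add_distrib, ← Finset.sum_add_distrib]
  refine Finset.sum_le_sum fun b _ => ?_
  have h1 : ∑ a, negMulLog (A a b + B a b) ≤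
      ∑ a, negMulLog (A a b) + ∑ a, negMulLog (B a b) := by
    rw [← Finset.sum_add_distrib]
    exact Finset.sum_le_sum fun a _ => negMulLog_add_le (hA a b) (hB a b)
  have h2 := negMulLog_add_negMulLog_le
    (Finset.sum_nonneg fun a (_ : a ∈ Finset.univ) => hA a b)
    (Finset.sum_nonneg fun a (_ : a ∈ Finset.univ) => hB a b)
  rw [Finset.sum_add_distrib]
  linarith

lemma condNegMulLog_le {A : α → β → ℝ} (hA : ∀ a b, 0 ≤ A a b) :
    condNegMulLog A ≤ (∑ b, ∑ a, A a b) * Real.log (Fintype.card α) := by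
  rw [condNegMulLog, Finset.sum_mul]
  refine Finset.sum_le_sum fun b _ => ?_
  linarith [sum_negMulLog_le fun a => hA a b]

lemma condNegMulLog_const_mul (c : ℝ) (A : α → β → ℝ) :
    condNegMulLog (fun a b => c * A a b) = c * condNegMulLog A := by
  simp only [condNegMulLog, ← Finset.mul_sum, negMulLog_mul, Finset.sum_add_distrib,
    ← Finset.sum_mul]
  rw [Finset.mul_sum]
  exact Finset.sum_congr rfl fun b _ => by ring

end CondNegMulLog

lemma sum_negMulLog_prod {α : Type*} [Fintype α] {q : α → ℝ} (hq : ∑ a, q a = 1) (n : ℕ) :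
    ∑ v : Fin n → α, negMulLog (∏ m, q (v m)) = n * ∑ a, negMulLog (q a) := by
  induction n with
  | zero => simp
  | succ n ih =>
    have hone : ∑ v : Fin n → α, ∏ m, q (v m) = 1 := by
      classical
      rw [← Fintype.piFinset_univ, ← Finset.prod_univ_sum]
      simp [hq]
    rw [← (Fin.consEquiv fun _ => α).sum_comp, Fintype.sum_prod_type]
    simp only [Fin.consEquiv_apply, Fin.prod_univ_succ, Fin.cons_zero, Fin.cons_succ,
      negMulLog_mul, Finset.sum_add_distrib, ← Finset.sum_mul, ← Finset.mul_sum, ih, hone, hq]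
    push_cast
    ring

lemma condNegMulLog_prod {𝒳 𝒴 : Type*} [Fintype 𝒳] [Fintype 𝒴] {p : 𝒳 → 𝒴 → ℝ}
    (hsum : ∑ x, ∑ y, p x y = 1) (n : ℕ) :
    condNegMulLog (fun (xs : Fin n → 𝒳) (ys : Fin n → 𝒴) => ∏ m, p (xs m) (ys m)) =
      n * condEntXY p * Real.log 2 := by
  classical
  have hmarg (ys : Fin n → 𝒴) :
      ∑ xs : Fin n → 𝒳, ∏ m, p (xs m) (ys m) = ∏ m, margY p (ys m) := by
    simp only [margY]
    rw [Finset.prod_univ_sum, Fintype.piFinset_univ]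
  have hY : ∑ y, margY p y = 1 := by
    simp only [margY]
    rw [Finset.sum_comm, hsum]
  have hjoint : ∑ ys : Fin n → 𝒴, ∑ xs : Fin n → 𝒳, negMulLog (∏ m, p (xs m) (ys m)) =
      n * ∑ q : 𝒳 × 𝒴, negMulLog (p q.1 q.2) := by
    rw [← sum_negMulLog_prod (q := fun q : 𝒳 × 𝒴 => p q.1 q.2)
      (by rw [Fintype.sum_prod_type, hsum]), Finset.sum_comm,
      ← Fintype.sum_prod_type'
        (f := fun (xs : Fin n → 𝒳) (ys : Fin n → 𝒴) => negMulLog (∏ m, p (xs m) (ys m))),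
      ← (Equiv.arrowProdEquivProdArrow (Fin n) (fun _ => 𝒳) (fun _ => 𝒴)).sum_comp]
    rfl
  have hlog : Real.log 2 ≠ 0 := (Real.log_pos one_lt_two).ne'
  simp only [condNegMulLog, hmarg, Finset.sum_sub_distrib, hjoint, sum_negMulLog_prod hY]
  rw [condEntXY, jointEnt, ent2_eq_sum_negMulLog, ent2_eq_sum_negMulLog]
  field_simp

section Measure

variable {Ω α β : Type*} [MeasurableSpace Ω] [Fintype α] [Fintype β]
  [MeasurableSpace α] [MeasurableSingletonClass α]

lemma sum_measureReal_fiber_inter (ν : Measure Ω) [IsFiniteMeasure ν] {U : Ω → α}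
    (hU : Measurable U) (S : Set Ω) :
    ∑ a, ν.real ({ω | U ω = a} ∩ S) = ν.real S := by
  have hm (a : α) : MeasurableSet (U ⁻¹' {a}) := hU (measurableSet_singleton a)
  have h := sum_measureReal_preimage_singleton (μ := ν.restrict S) Finset.univ
    (f := U) fun a _ => hm a
  simp only [measureReal_restrict_apply (hm _), Finset.coe_univ, Set.preimage_univ,
    measureReal_restrict_apply_univ] at h
  exact h

lemma condEnt2_eq (ν : Measure Ω) [IsFiniteMeasure ν] {U : Ω → α} (V : Ω → β)
    (hU : Measurable U) :
    condEnt2 ν U V =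
      condNegMulLog (fun a b => ν.real {ω | U ω = a ∧ V ω = b}) / Real.log 2 := by
  have h (b : β) : ∑ a, ν.real {ω | U ω = a ∧ V ω = b} = ν.real {ω | V ω = b} :=
    sum_measureReal_fiber_inter ν hU {ω | V ω = b}
  simp only [condNegMulLog, h]
  rw [condEnt2, ent2_eq_sum_negMulLog, ent2_eq_sum_negMulLog, Fintype.sum_prod_type,
    Finset.sum_comm, Finset.sum_sub_distrib, sub_div]
  rfl

variable [MeasurableSpace β] [MeasurableSingletonClass β]

lemma sum_sum_measureReal_fibers_inter (ν : Measure Ω) [IsFiniteMeasure ν] {U : Ω → α}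
    {V : Ω → β} (hU : Measurable U) (hV : Measurable V) (S : Set Ω) :
    ∑ b, ∑ a, ν.real ({ω | U ω = a ∧ V ω = b} ∩ S) = ν.real S := by
  rw [← sum_measureReal_fiber_inter ν hV S]
  refine Finset.sum_congr rfl fun b _ => ?_
  rw [← sum_measureReal_fiber_inter ν hU]
  simp only [← Set.inter_assoc]
  rfl

/-- Conditional entropy on finite alphabets is at most the logarithm of the alphabet size. -/
lemma condEnt2_le_logb_card (ν : Measure Ω) [IsZeroOrProbabilityMeasure ν] {U : Ω → α}
    {V : Ω → β} (hU : Measurable U) (hV : Measurable V) :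
    condEnt2 ν U V ≤ Real.logb 2 (Fintype.card α) := by
  rw [condEnt2_eq ν V hU, Real.logb]
  refine div_le_div_of_nonneg_right ?_ (Real.log_nonneg one_le_two)
  refine (condNegMulLog_le fun _ _ => measureReal_nonneg).trans ?_
  have h := sum_sum_measureReal_fibers_inter ν hU hV Set.univ
  simp only [Set.inter_univ] at h
  rw [h]
  exact mul_le_of_le_one_left (Real.log_natCast_nonneg _) measureReal_le_one

/-- Conditioning on the complement of an event of probability `δ` decreases the conditional
entropy of `U` given `V` by at most `1 + δ log |α|`, up to the factor `1 - δ`. -/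
lemma condNegMulLog_le_condEnt2_cond (μ : Measure Ω) [IsProbabilityMeasure μ] {U : Ω → α}
    {V : Ω → β} (hU : Measurable U) (hV : Measurable V) {S : Set Ω} (hS : MeasurableSet S) :
    condNegMulLog (fun a b => μ.real {ω | U ω = a ∧ V ω = b}) / Real.log 2 ≤
      (1 - μ.real Sᶜ) * condEnt2 (ProbabilityTheory.cond μ S) U V +
        μ.real Sᶜ * Real.logb 2 (Fintype.card α) + 1 := by
  have hlog : 0 < Real.log 2 := Real.log_pos one_lt_two
  set A : α → β → ℝ := fun a b => μ.real ({ω | U ω = a ∧ V ω = b} ∩ S) with hA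
  set B : α → β → ℝ := fun a b => μ.real ({ω | U ω = a ∧ V ω = b} ∩ Sᶜ) with hB
  have hAB : (fun a b => μ.real {ω | U ω = a ∧ V ω = b}) = fun a b => A a b + B a b := by
    funext a b
    exact (measureReal_inter_add_sdiff hS).symm
  have hcond : A = fun a b => μ.real S *
      (ProbabilityTheory.cond μ S).real {ω | U ω = a ∧ V ω = b} := by
    funext a b
    rw [measureReal_def (ProbabilityTheory.cond μ S), cond_apply hS, ENNReal.toReal_mul,
      ENNReal.toReal_inv, ← measureReal_def, ← measureReal_def, Set.inter_comm S]
    by_cases h0 : μ.real S = 0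
    · simp only [h0, zero_mul, hA]
      exact le_antisymm (h0 ▸ measureReal_mono Set.inter_subset_right) measureReal_nonneg
    · rw [mul_inv_cancel_left₀ h0]
  have hS' : 1 - μ.real Sᶜ = μ.real S := by
    rw [probReal_compl_eq_one_sub hS]
    ring
  have htot : ∑ b, ∑ a, (A a b + B a b) = 1 := by
    simp only [Finset.sum_add_distrib, hA, hB, sum_sum_measureReal_fibers_inter μ hU hV]
    linarith
  have hsub := condNegMulLog_add_le (A := A) (B := B) (fun _ _ => measureReal_nonneg)
    (fun _ _ => measureReal_nonneg)
  have hBle := condNegMulLog_le (A := B) (fun _ _ => measureReal_nonneg)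
  rw [sum_sum_measureReal_fibers_inter μ hU hV] at hBle
  have hAeq : condNegMulLog A =
      (1 - μ.real Sᶜ) * condEnt2 (ProbabilityTheory.cond μ S) U V * Real.log 2 := by
    rw [hcond, condNegMulLog_const_mul, condEnt2_eq _ V hU, hS']
    field_simp
  rw [htot, hAeq] at hsub
  rw [hAB, div_le_iff₀ hlog, Real.logb]
  have : (μ.real Sᶜ * (Real.log (Fintype.card α) / Real.log 2)) * Real.log 2 =
    μ.real Sᶜ * Real.log (Fintype.card α) := by field_simp
  linarith

end Measure

/-- **Converse part of the test theorem.** For each `M`, let `E M` be a `{0,1}`-valued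
random variable such that conditionally on `E M = 1` the sequence `X^M` lies almost surely
in `A_ε^{(M)}(X)`, and let `P_f^{(M)} = Pr{E M = 1}` with accuracy
`Î_M(X;Y) = H(X) − (1/M) H(X^M | Y^M, E M = 0)`.  If `P_f^{(M)} → 0`, then
`limsup Î_M(X;Y) ≤ I(X;Y)`: no test method achieves accuracy greater than the test
information when the probability of test failure tends to zero. -/
theorem converse_test_theorem {Ω 𝒳 𝒴 : Type*} [MeasurableSpace Ω] (μ : Measure Ω)
    [IsProbabilityMeasure μ]
    [Fintype 𝒳] [MeasurableSpace 𝒳] [DiscreteMeasurableSpace 𝒳]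
    [Fintype 𝒴] [MeasurableSpace 𝒴] [DiscreteMeasurableSpace 𝒴]
    (p : 𝒳 → 𝒴 → ℝ) (hpos : ∀ x y, 0 < p x y) (hsum : ∑ x, ∑ y, p x y = 1)
    (ε : ℝ) (hε : 0 < ε)
    (X : ℕ → Ω → 𝒳) (Y : ℕ → Ω → 𝒴)
    (hmeasX : ∀ n, Measurable (X n)) (hmeasY : ∀ n, Measurable (Y n))
    (hiid : ∀ (M : ℕ) (xs : Fin M → 𝒳) (ys : Fin M → 𝒴),
      (μ {ω | ∀ m : Fin M, X m ω = xs m ∧ Y m ω = ys m}).toReal = ∏ m, p (xs m) (ys m))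
    (E : ℕ → Ω → Fin 2) (hmeasE : ∀ M, Measurable (E M))
    (hcond : ∀ M : ℕ,
      μ {ω | E M ω = 1 ∧ ¬ typ (margX p) ε M (fun m : Fin M => X m ω)} = 0)
    (hPf : Filter.Tendsto (fun M : ℕ => (μ {ω | E M ω = 1}).toReal) Filter.atTop (nhds 0)) :
    Filter.limsup
        (fun M : ℕ =>
          ent2 (margX p) -
            (1 / (M : ℝ)) *
              condEnt2 (ProbabilityTheory.cond μ {ω | E M ω = 0})
                (fun ω (m : Fin M) => X m ω) (fun ω (m : Fin M) => Y m ω))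
        Filter.atTop
      ≤ mutInfo p := by
  have hX (M : ℕ) : Measurable fun ω (m : Fin M) => X m ω :=
    measurable_pi_lambda _ fun m => hmeasX m
  have hY (M : ℕ) : Measurable fun ω (m : Fin M) => Y m ω :=
    measurable_pi_lambda _ fun m => hmeasY m
  set L := Real.logb 2 (Fintype.card 𝒳) with hL
  set c : ℕ → ℝ := fun M => condEnt2 (ProbabilityTheory.cond μ {ω | E M ω = 0})
    (fun ω (m : Fin M) => X m ω) (fun ω (m : Fin M) => Y m ω) with hc
  set δ : ℕ → ℝ := fun M => μ.real {ω | E M ω = 1} with hδ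
  have hcard (M : ℕ) : Real.logb 2 (Fintype.card (Fin M → 𝒳)) = M * L := by
    simp [hL, Real.logb_pow]
  have hupper (M : ℕ) : c M ≤ M * L :=
    (condEnt2_le_logb_card _ (hX M) (hY M)).trans (hcard M).le
  have hlower (M : ℕ) : M * condEntXY p ≤ (1 - δ M) * c M + δ M * (M * L) + 1 := by
    have h := condNegMulLog_le_condEnt2_cond μ (hX M) (hY M)
      (S := {ω | E M ω = 0}) (hmeasE M (measurableSet_singleton 0))
    have hcompl : {ω | E M ω = 0}ᶜ = {ω | E M ω = 1} := by
      ext ω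
      simp only [Set.mem_compl_iff, Set.mem_ofPred_eq]
      omega
    have hlaw : (fun (xs : Fin M → 𝒳) (ys : Fin M → 𝒴) =>
        μ.real {ω | (fun m : Fin M => X m ω) = xs ∧ (fun m : Fin M => Y m ω) = ys}) =
        fun xs ys => ∏ m, p (xs m) (ys m) := by
      funext xs ys
      rw [← hiid M xs ys, Measure.real]
      simp only [funext_iff, forall_and]
    rwa [hlaw, condNegMulLog_prod hsum, hcompl, hcard,
      mul_div_cancel_right₀ _ (Real.log_pos one_lt_two).ne'] at h
  have hbound : ∀ᶠ M : ℕ in atTop, ent2 (margX p) - 1 / (M : ℝ) * c M ≤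
      ent2 (margX p) - (condEntXY p - δ M * L - 1 / (M : ℝ)) / (1 - δ M) := by
    filter_upwards [hPf.eventually_lt_const one_pos, eventually_gt_atTop 0] with M hM hM0
    have hM0' : (0 : ℝ) < M := by exact_mod_cast hM0
    have hM1 : 0 < 1 - δ M := sub_pos.2 hM
    refine sub_le_sub_left ?_ _
    rw [div_le_iff₀ hM1, ← mul_le_mul_iff_right₀ hM0']
    have e1 : (M : ℝ) * (condEntXY p - δ M * L - 1 / M) =
        M * condEntXY p - δ M * (M * L) - 1 := by field_simp
    have e2 : (M : ℝ) * (1 / M * c M * (1 - δ M)) = (1 - δ M) * c M := by field_simp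
    rw [e1, e2]
    linarith [hlower M]
  have hlim : Tendsto (fun M : ℕ =>
      ent2 (margX p) - (condEntXY p - δ M * L - 1 / (M : ℝ)) / (1 - δ M)) atTop
      (nhds (mutInfo p)) := by
    have hδ0 : Tendsto δ atTop (nhds 0) := hPf
    have h := ((((hδ0.mul_const L).const_sub (condEntXY p)).sub
      tendsto_one_div_atTop_nhds_zero_nat).div (hδ0.const_sub 1) (by norm_num)).const_sub
        (ent2 (margX p))
    have hval : mutInfo p =
        ent2 (margX p) - (condEntXY p - 0 * L - 0) / (1 - 0) := by
      rw [mutInfo, condEntXY]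
      ring
    rw [hval]
    exact h
  have hge : ∀ᶠ M : ℕ in atTop, ent2 (margX p) - L ≤ ent2 (margX p) - 1 / (M : ℝ) * c M := by
    filter_upwards [eventually_gt_atTop 0] with M hM0
    have hM0' : (0 : ℝ) < M := by exact_mod_cast hM0
    have h := hupper M
    refine sub_le_sub_left ?_ _
    rw [one_div_mul_eq_div, div_le_iff₀ hM0']
    linarith
  rw [← hlim.limsup_eq]
  exact limsup_le_limsup hbound (isBoundedUnder_of_eventually_ge hge).isCoboundedUnder_le
    hlim.isBoundedUnder_le
end
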